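/- In the multi-server secure aggregation model with heterogeneous security constraints, for every n ∈ [N], it holds that H({Z_{u,v}}_{(u,v)∈𝒯_n∩𝒮̄} | {Z_{u,v}}_{(u,v)∈𝒯_n∖𝒮̄}) ≥ |𝒯_n ∩ 𝒮̄|·L. -/

import Mathlib

open Finset

open scoped Classical

noncomputable section

/-- Probability that the random variable `X` takes the value `s`, under the weights `μ`. -/
def prb {Ω : Type} [Fintype Ω] (μ : Ω → ℝ) {α : Type} (X : Ω → α) (s : α) : ℝ :=
  ∑ ω ∈ Finset.univ.filter fun ω => X ω = s, μ ω

/-- Shannon entropy of `X` in `q`-ary units. -/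
def ent (q : ℕ) {Ω : Type} [Fintype Ω] (μ : Ω → ℝ) {α : Type} [Fintype α] (X : Ω → α) : ℝ :=
  -∑ s : α, prb μ X s * Real.logb q (prb μ X s)

/-- Conditional entropy `H(X | Y)` in `q`-ary units. -/
def condEnt (q : ℕ) {Ω : Type} [Fintype Ω] (μ : Ω → ℝ) {α β : Type} [Fintype α] [Fintype β]
    (X : Ω → α) (Y : Ω → β) : ℝ :=
  ent q μ (fun ω => (X ω, Y ω)) - ent q μ Y

/-- Conditional mutual information `I(X ; Y ∣ Z)` in `q`-ary units. -/
def mutInfo (q : ℕ) {Ω : Type} [Fintype Ω] (μ : Ω → ℝ) {α β γ : Type}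
    [Fintype α] [Fintype β] [Fintype γ] (X : Ω → α) (Y : Ω → β) (Z : Ω → γ) : ℝ :=
  condEnt q μ X Z - condEnt q μ X fun ω => (Y ω, Z ω)

/-- The joint random variable formed by the members of a family of random variables
indexed by a finset. -/
def restr {Ω ι α : Type} (Z : ι → Ω → α) (T : Finset ι) : Ω → { i // i ∈ T } → α :=
  fun ω i => Z i.1 ω

/-- The set of users `𝒦`: user `⟨u,v⟩` is the `v`-th user of server `u`. -/
abbrev Usr (U : ℕ) (V : Fin U → ℕ) : Type := Σ u : Fin U, Fin (V u)

/-- Total number of users, `K = ∑ u, V u`. -/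
def Ktot (U : ℕ) (V : Fin U → ℕ) : ℕ := ∑ u, V u

/-- The users connected to server `u`, `𝒦_{{u}}`. -/
def Ksrv (U : ℕ) (V : Fin U → ℕ) (u : Fin U) : Finset (Usr U V) :=
  Finset.univ.filter fun i => i.1 = u

/-- The users connected to a set of servers, `𝒦_𝒰`. -/
def KsrvSet (U : ℕ) (V : Fin U → ℕ) (A : Finset (Fin U)) : Finset (Usr U V) :=
  Finset.univ.filter fun i => i.1 ∈ A

/-- The set of servers `𝒰^{(m,n)}` associated with a security input set `Sm` and a
colluding set `Tn`. -/
def UServers (U : ℕ) (V : Fin U → ℕ) (Sm Tn : Finset (Usr U V)) : Finset (Fin U) :=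
  Finset.univ.filter fun u =>
    (Sm ∩ Ksrv U V u).Nonempty ∧ ((Sm ∪ Tn) ∩ Ksrv U V u).card = V u

/-- The set `(𝒮_m ∩ 𝒦_{{u}}) ∪ 𝒦_{𝒰^{(m,n)}} ∪ 𝒯_n`. -/
def BigB (U : ℕ) (V : Fin U → ℕ) (Sm Tn : Finset (Usr U V)) (u : Fin U) : Finset (Usr U V) :=
  (Sm ∩ Ksrv U V u) ∪ KsrvSet U V (UServers U V Sm Tn) ∪ Tn

/-- The implicit security input set `𝒮_I`. -/
def SImp (U : ℕ) (V : Fin U → ℕ) {M N : ℕ} (S : Fin M → Finset (Usr U V))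
    (T : Fin N → Finset (Usr U V)) : Finset (Usr U V) :=
  Finset.univ.filter fun i =>
    (∀ m, i ∉ S m) ∧
    ∃ u m n, (BigB U V (S m) (T n) u).card = Ktot U V - 1 ∧ i ∉ BigB U V (S m) (T n) u

/-- The total security input set `𝒮̄`. -/
def Sbar (U : ℕ) (V : Fin U → ℕ) {M N : ℕ} (S : Fin M → Finset (Usr U V))
    (T : Fin N → Finset (Usr U V)) : Finset (Usr U V) :=
  (Finset.univ.biUnion fun m => S m) ∪ SImp U V S T

/-- The set `𝒜_{u,m,n}`. -/
def Aset (U : ℕ) (V : Fin U → ℕ) {M N : ℕ} (S : Fin M → Finset (Usr U V))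
    (T : Fin N → Finset (Usr U V)) (u : Fin U) (m : Fin M) (n : Fin N) : Finset (Usr U V) :=
  BigB U V (S m) (T n) u ∩ Sbar U V S T

/-- `a* = max_{u,m,n} |𝒜_{u,m,n}|`. -/
def aStar (U : ℕ) (V : Fin U → ℕ) {M N : ℕ} (S : Fin M → Finset (Usr U V))
    (T : Fin N → Finset (Usr U V)) : ℕ :=
  Finset.univ.sup fun t : Fin U × Fin M × Fin N => (Aset U V S T t.1 t.2.1 t.2.2).card

/-- `|((𝒮_m ∩ 𝒦_{{u}}) ∪ 𝒯_n) ∩ 𝒮̄| + |𝒰^{(m,n)} ∖ {u}|`. -/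
def eVal (U : ℕ) (V : Fin U → ℕ) {M N : ℕ} (S : Fin M → Finset (Usr U V))
    (T : Fin N → Finset (Usr U V)) (u : Fin U) (m : Fin M) (n : Fin N) : ℕ :=
  (((S m ∩ Ksrv U V u) ∪ T n) ∩ Sbar U V S T).card + ((UServers U V (S m) (T n)).erase u).card

/-- `e* = max_{u,m,n} (|((𝒮_m ∩ 𝒦_{{u}}) ∪ 𝒯_n) ∩ 𝒮̄| + |𝒰^{(m,n)} ∖ {u}|)`. -/
def eStar (U : ℕ) (V : Fin U → ℕ) {M N : ℕ} (S : Fin M → Finset (Usr U V))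
    (T : Fin N → Finset (Usr U V)) : ℕ :=
  Finset.univ.sup fun t : Fin U × Fin M × Fin N => eVal U V S T t.1 t.2.1 t.2.2

/-- The set `𝒬_1`. -/
def Q1set (U : ℕ) (V : Fin U → ℕ) {M N : ℕ} (S : Fin M → Finset (Usr U V))
    (T : Fin N → Finset (Usr U V)) : Finset (Usr U V) :=
  (Finset.univ.filter fun t : Fin U × Fin M × Fin N =>
      (Aset U V S T t.1 t.2.1 t.2.2).card = (Sbar U V S T).card).biUnion
    fun t => BigB U V (S t.2.1) (T t.2.2) t.1

/-- The set `𝒬_2`. -/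
def Q2set (U : ℕ) (V : Fin U → ℕ) {M N : ℕ} (S : Fin M → Finset (Usr U V))
    (T : Fin N → Finset (Usr U V)) : Finset (Usr U V) :=
  (Finset.univ.filter fun t : Fin U × Fin M × Fin N =>
      eVal U V S T t.1 t.2.1 t.2.2 = eStar U V S T).biUnion
    fun t => BigB U V (S t.2.1) (T t.2.2) t.1

/-- The set `𝒬`. -/
def Qset (U : ℕ) (V : Fin U → ℕ) {M N : ℕ} (S : Fin M → Finset (Usr U V))
    (T : Fin N → Finset (Usr U V)) : Finset (Usr U V) :=
  if (Q1set U V S T).Nonempty then Q1set U V S T ∪ Q2set U V S T else ∅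

/-- A secure-aggregation scheme: all structural, distributional, correctness and
security constraints of the multi-server secure aggregation model, with entropies in
`q`-ary units for `q = |F|`. -/
def IsScheme (U : ℕ) (V : Fin U → ℕ) (M N : ℕ) (S : Fin M → Finset (Usr U V))
    (T : Fin N → Finset (Usr U V)) (F : Type) [Field F] [Fintype F]
    (Ω : Type) [Fintype Ω] (μ : Ω → ℝ) (L LX LY LZ LSig : ℕ)
    (W : Usr U V → Ω → Fin L → F) (Z : Usr U V → Ω → Fin LZ → F)
    (X : Usr U V → Ω → Fin LX → F) (Y : Fin U → Ω → Fin LY → F)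
    (ZS : Ω → Fin LSig → F) : Prop :=
  let q := Fintype.card F
  (1 ≤ L) ∧
  (∀ ω, 0 ≤ μ ω) ∧ (∑ ω, μ ω = 1) ∧
  -- each input consists of `L` i.i.d. uniform `q`-ary symbols
  (∀ i, ent q μ (W i) = L) ∧
  -- the inputs are mutually independent of each other and of all keys
  (ent q μ (fun ω => (restr W Finset.univ ω, restr Z Finset.univ ω)) =
    ent q μ (restr Z Finset.univ) + ∑ i, ent q μ (W i)) ∧
  -- the source key consists of `LSig` i.i.d. uniform `q`-ary symbols
  (ent q μ ZS = LSig) ∧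
  -- the individual keys are deterministic functions of the source key
  (condEnt q μ (restr Z Finset.univ) ZS = 0) ∧
  -- each user message is a deterministic function of its input and key
  (∀ i, condEnt q μ (X i) (fun ω => (W i ω, Z i ω)) = 0) ∧
  -- each server message is a deterministic function of its received messages
  (∀ u, condEnt q μ (Y u) (restr X (Ksrv U V u)) = 0) ∧
  -- correctness
  (∀ k, condEnt q μ (fun ω => ∑ i, W i ω)
    (fun ω => (restr Y (Finset.univ.erase k) ω, restr X (Ksrv U V k) ω)) = 0) ∧
  -- security
  (∀ k m n, mutInfo q μ
    (fun ω => (restr Y (Finset.univ.erase k) ω, restr X (Ksrv U V k) ω))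
    (restr W (S m))
    (fun ω => (∑ i, W i ω, restr W (T n) ω, restr Z (T n) ω)) = 0)

/-- A rate tuple `(R_X, R_Y, R_{Z_Σ})` is achievable. -/
def Achievable (U : ℕ) (V : Fin U → ℕ) (M N : ℕ) (S : Fin M → Finset (Usr U V))
    (T : Fin N → Finset (Usr U V)) (R : ℝ × ℝ × ℝ) : Prop :=
  ∃ (F : Type) (iF : Field F) (iFt : Fintype F) (Ω : Type) (iΩ : Fintype Ω)
    (μ : Ω → ℝ) (L LX LY LZ LSig : ℕ)
    (W : Usr U V → Ω → Fin L → F) (Z : Usr U V → Ω → Fin LZ → F)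
    (X : Usr U V → Ω → Fin LX → F) (Y : Fin U → Ω → Fin LY → F)
    (ZS : Ω → Fin LSig → F),
    R.1 = (LX : ℝ) / (L : ℝ) ∧ R.2.1 = (LY : ℝ) / (L : ℝ) ∧ R.2.2 = (LSig : ℝ) / (L : ℝ) ∧
    @IsScheme U V M N S T F iF iFt Ω iΩ μ L LX LY LZ LSig W Z X Y ZS

end

theorem restr_eq_iff {Ω ι α : Type} {Z : ι → Ω → α} {T : Finset ι} {ω ω' : Ω} :
    restr Z T ω = restr Z T ω' ↔ ∀ i ∈ T, Z i ω = Z i ω' := by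
  simp [restr, funext_iff]

section Entropy

variable {Ω : Type} [Fintype Ω] {μ : Ω → ℝ} {α β γ δ : Type}

theorem le_prb_self (h0 : ∀ ω, 0 ≤ μ ω) (X : Ω → α) (ω : Ω) : μ ω ≤ prb μ X (X ω) :=
  Finset.single_le_sum (f := μ) (fun i _ => h0 i) (by simp)

theorem prb_self_pos (h0 : ∀ ω, 0 ≤ μ ω) (X : Ω → α) {ω : Ω} (hω : μ ω ≠ 0) :
    0 < prb μ X (X ω) :=
  lt_of_lt_of_le (lt_of_le_of_ne (h0 ω) hω.symm) (le_prb_self h0 X ω)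

theorem prb_nonneg (h0 : ∀ ω, 0 ≤ μ ω) (X : Ω → α) (s : α) : 0 ≤ prb μ X s :=
  Finset.sum_nonneg fun ω _ => h0 ω

theorem ent_eq_sum [Fintype α] (q : ℕ) (X : Ω → α) :
    ent q μ X = -∑ ω, μ ω * Real.logb q (prb μ X (X ω)) := by
  rw [ent, ← Finset.sum_fiberwise Finset.univ X]
  congr 1
  refine Finset.sum_congr rfl fun s _ => ?_
  rw [prb, Finset.sum_mul]
  refine Finset.sum_congr rfl fun ω hω => ?_
  rw [(Finset.mem_filter.1 hω).2, prb]

/-- Entropy is monotone under passing to a finer random variable. -/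
theorem ent_mono [Fintype α] [Fintype β] {q : ℕ} (hq : 1 < q) (h0 : ∀ ω, 0 ≤ μ ω)
    {X : Ω → α} {Y : Ω → β} (h : X.FactorsThrough Y) : ent q μ X ≤ ent q μ Y := by
  rw [ent_eq_sum, ent_eq_sum]
  refine neg_le_neg (Finset.sum_le_sum fun ω _ => ?_)
  by_cases hω : μ ω = 0
  · simp [hω]
  refine mul_le_mul_of_nonneg_left ?_ (h0 ω)
  refine Real.logb_le_logb_of_le (by exact_mod_cast hq) (prb_self_pos h0 Y hω) ?_
  refine Finset.sum_le_sum_of_subset_of_nonneg (fun ω' hω' => ?_) fun ω _ _ => h0 ω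
  simp only [Finset.mem_filter, Finset.mem_univ, true_and] at hω' ⊢
  exact h hω'

/-- Gibbs' inequality for a weighted sum of logarithms. -/
theorem sum_mul_logb_nonpos {q : ℕ} (hq : 1 < q) (h0 : ∀ ω, 0 ≤ μ ω) (h1 : ∑ ω, μ ω = 1)
    {f : Ω → ℝ} (hf : ∀ ω, μ ω ≠ 0 → 0 < f ω) (hs : ∑ ω, μ ω * f ω ≤ 1) :
    ∑ ω, μ ω * Real.logb q (f ω) ≤ 0 := by
  have hlog : 0 < Real.log q := Real.log_pos (by exact_mod_cast hq)
  have key : ∑ ω, μ ω * Real.log (f ω) ≤ ∑ ω, (μ ω * f ω - μ ω) := by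
    refine Finset.sum_le_sum fun ω _ => ?_
    by_cases hω : μ ω = 0
    · simp [hω]
    have := mul_le_mul_of_nonneg_left (Real.log_le_sub_one_of_pos (hf ω hω)) (h0 ω)
    linarith
  rw [Finset.sum_sub_distrib, h1] at key
  have e : ∑ ω, μ ω * Real.logb q (f ω) = (∑ ω, μ ω * Real.log (f ω)) / Real.log q := by
    rw [Finset.sum_div]
    exact Finset.sum_congr rfl fun ω _ => by rw [Real.logb, mul_div_assoc]
  rw [e]
  exact div_nonpos_of_nonpos_of_nonneg (by linarith) hlog.le

theorem sum_div_prb_le_one (h0 : ∀ ω, 0 ≤ μ ω) (X : Ω → α) (s : Finset Ω)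
    (hs : ∀ ω ∈ s, ∀ ω' ∈ s, X ω = X ω') : ∑ ω ∈ s, μ ω / prb μ X (X ω) ≤ 1 := by
  rcases s.eq_empty_or_nonempty with rfl | ⟨ω₀, h₀⟩
  · simp
  rw [Finset.sum_congr rfl fun ω hω => by rw [hs ω hω ω₀ h₀], ← Finset.sum_div]
  refine div_le_one_of_le₀ ?_ (prb_nonneg h0 _ _)
  refine Finset.sum_le_sum_of_subset_of_nonneg (fun ω hω => ?_) fun ω _ _ => h0 ω
  simpa using hs ω hω ω₀ h₀

/-- Entropy is at most the logarithm of the number of values. -/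
theorem ent_le_logb_card [Fintype α] {q : ℕ} (hq : 1 < q) (h0 : ∀ ω, 0 ≤ μ ω)
    (h1 : ∑ ω, μ ω = 1) (X : Ω → α) : ent q μ X ≤ Real.logb q (Fintype.card α) := by
  have hΩ : Nonempty Ω := by
    by_contra h
    rw [not_nonempty_iff] at h
    simp at h1
  have hc : (0 : ℝ) < Fintype.card α := by
    exact_mod_cast Fintype.card_pos_iff.2 (hΩ.map X)
  have key := sum_mul_logb_nonpos hq h0 h1
    (f := fun ω => (Fintype.card α : ℝ)⁻¹ * (prb μ X (X ω))⁻¹)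
    (fun ω hω => by have := prb_self_pos h0 X hω; positivity) (by
      have : ∑ ω, μ ω / prb μ X (X ω) ≤ Fintype.card α := by
        rw [← Finset.sum_fiberwise Finset.univ X]
        refine (Finset.sum_le_sum fun s _ => sum_div_prb_le_one h0 X _ ?_).trans (by simp)
        intro ω hω ω' hω'
        rw [(Finset.mem_filter.1 hω).2, (Finset.mem_filter.1 hω').2]
      calc _ = (Fintype.card α : ℝ)⁻¹ * ∑ ω, μ ω / prb μ X (X ω) := by
            rw [Finset.mul_sum]
            exact Finset.sum_congr rfl fun ω _ => by ring
        _ ≤ (Fintype.card α : ℝ)⁻¹ * Fintype.card α := by gcongr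
        _ = 1 := inv_mul_cancel₀ hc.ne')
  have e : ∑ ω, μ ω * Real.logb q ((Fintype.card α : ℝ)⁻¹ * (prb μ X (X ω))⁻¹) =
      ∑ ω, (-(μ ω * Real.logb q (Fintype.card α)) - μ ω * Real.logb q (prb μ X (X ω))) := by
    refine Finset.sum_congr rfl fun ω _ => ?_
    by_cases hω : μ ω = 0
    · simp [hω]
    have hp := prb_self_pos h0 X hω
    rw [Real.logb_mul (by positivity) (by positivity), Real.logb_inv, Real.logb_inv]
    ring
  rw [e, Finset.sum_sub_distrib, Finset.sum_neg_distrib, ← Finset.sum_mul, h1] at key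
  rw [ent_eq_sum]
  linarith

theorem sum_prb_mul_prb_div_le_one (h0 : ∀ ω, 0 ≤ μ ω) (h1 : ∑ ω, μ ω = 1)
    {A : Ω → α} {B : Ω → β} {J : Ω → γ} {M : Ω → δ}
    (hJ : J.FactorsThrough fun ω => (A ω, B ω))
    (hA : M.FactorsThrough A) (hB : M.FactorsThrough B) :
    ∑ ω, μ ω * (prb μ A (A ω) * prb μ B (B ω) / (prb μ J (J ω) * prb μ M (M ω))) ≤ 1 := by
  have expand : ∀ ω, μ ω * (prb μ A (A ω) * prb μ B (B ω) / (prb μ J (J ω) * prb μ M (M ω))) =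
      ∑ ω₁, ∑ ω₂, if A ω₁ = A ω ∧ B ω₂ = B ω then
        (μ ω₁ * μ ω₂ / prb μ M (M ω₁)) * (μ ω / prb μ J (J ω)) else 0 := by
    intro ω
    have : prb μ A (A ω) * prb μ B (B ω) =
        ∑ ω₁, ∑ ω₂, if A ω₁ = A ω ∧ B ω₂ = B ω then μ ω₁ * μ ω₂ else 0 := by
      rw [prb, prb, Finset.sum_filter, Finset.sum_filter, Finset.sum_mul_sum]
      refine Finset.sum_congr rfl fun _ _ => Finset.sum_congr rfl fun _ _ => ?_
      split_ifs <;> simp_all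
    rw [this, Finset.sum_div, Finset.mul_sum]
    refine Finset.sum_congr rfl fun ω₁ _ => ?_
    rw [Finset.sum_div, Finset.mul_sum]
    refine Finset.sum_congr rfl fun ω₂ _ => ?_
    split_ifs with h
    · rw [hA h.1]; ring
    · simp
  rw [Finset.sum_congr rfl fun ω _ => expand ω, Finset.sum_comm]
  calc _ ≤ ∑ ω₁, μ ω₁ := Finset.sum_le_sum fun ω₁ _ => ?_
    _ = 1 := h1
  rw [Finset.sum_comm]
  calc _ ≤ ∑ ω₂, (if M ω₂ = M ω₁ then μ ω₁ * μ ω₂ / prb μ M (M ω₁) else 0) :=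
        Finset.sum_le_sum fun ω₂ _ => ?_
    _ = μ ω₁ * prb μ M (M ω₁) / prb μ M (M ω₁) := by
        rw [← Finset.sum_filter, ← Finset.sum_div, ← Finset.mul_sum]
        rfl
    _ ≤ μ ω₁ := by
        by_cases h : prb μ M (M ω₁) = 0
        · simp [h, h0]
        · rw [mul_div_cancel_right₀ _ h]
  rw [← Finset.sum_filter, ← Finset.mul_sum]
  have hnn : 0 ≤ μ ω₁ * μ ω₂ / prb μ M (M ω₁) :=
    div_nonneg (mul_nonneg (h0 _) (h0 _)) (prb_nonneg h0 _ _)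
  split_ifs with h
  · refine mul_le_of_le_one_right hnn (sum_div_prb_le_one h0 J _ fun ω hω ω' hω' => hJ ?_)
    simp only [Finset.mem_filter] at hω hω'
    exact Prod.ext (hω.2.1.symm.trans hω'.2.1) (hω.2.2.symm.trans hω'.2.2)
  · rw [Finset.filter_false_of_mem, Finset.sum_empty, mul_zero]
    exact fun ω _ hω => h ((hB hω.2).trans (hA hω.1).symm)

/-- Submodularity of entropy. -/
theorem ent_add_ent_le [Fintype α] [Fintype β] [Fintype γ] [Fintype δ] {q : ℕ} (hq : 1 < q)
    (h0 : ∀ ω, 0 ≤ μ ω) (h1 : ∑ ω, μ ω = 1)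
    {A : Ω → α} {B : Ω → β} {J : Ω → γ} {M : Ω → δ}
    (hJ : J.FactorsThrough fun ω => (A ω, B ω))
    (hA : M.FactorsThrough A) (hB : M.FactorsThrough B) :
    ent q μ J + ent q μ M ≤ ent q μ A + ent q μ B := by
  have key := sum_mul_logb_nonpos hq h0 h1 (fun ω hω => by
    have := prb_self_pos h0 A hω
    have := prb_self_pos h0 B hω
    have := prb_self_pos h0 J hω
    have := prb_self_pos h0 M hω
    positivity) (sum_prb_mul_prb_div_le_one h0 h1 hJ hA hB)
  have e : ∑ ω, μ ω * Real.logb q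
        (prb μ A (A ω) * prb μ B (B ω) / (prb μ J (J ω) * prb μ M (M ω))) =
      ∑ ω, (μ ω * Real.logb q (prb μ A (A ω)) + μ ω * Real.logb q (prb μ B (B ω)) -
        μ ω * Real.logb q (prb μ J (J ω)) - μ ω * Real.logb q (prb μ M (M ω))) := by
    refine Finset.sum_congr rfl fun ω _ => ?_
    by_cases hω : μ ω = 0
    · simp [hω]
    have hpA := (prb_self_pos h0 A hω).ne'
    have hpB := (prb_self_pos h0 B hω).ne'
    have hpJ := (prb_self_pos h0 J hω).ne'
    have hpM := (prb_self_pos h0 M hω).ne'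
    rw [Real.logb_div (mul_ne_zero hpA hpB) (mul_ne_zero hpJ hpM), Real.logb_mul hpA hpB,
      Real.logb_mul hpJ hpM]
    ring
  rw [e, Finset.sum_sub_distrib, Finset.sum_sub_distrib, Finset.sum_add_distrib] at key
  simp only [ent_eq_sum]
  linarith

/-- Subadditivity of entropy. -/
theorem ent_le_add [Fintype α] [Fintype β] [Fintype γ] {q : ℕ} (hq : 1 < q)
    (h0 : ∀ ω, 0 ≤ μ ω) (h1 : ∑ ω, μ ω = 1) {A : Ω → α} {B : Ω → β} {J : Ω → γ}
    (hJ : J.FactorsThrough fun ω => (A ω, B ω)) : ent q μ J ≤ ent q μ A + ent q μ B := by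
  have h := ent_add_ent_le hq h0 h1 (M := fun _ => ()) hJ (fun _ _ _ => rfl) fun _ _ _ => rfl
  have h' : ent q μ (fun _ : Ω => ()) = 0 := by simp [ent, prb, h1]
  linarith

section CondEnt

variable [Fintype α] [Fintype β] [Fintype γ] {q : ℕ}

theorem condEnt_nonpos_of_factorsThrough (hq : 1 < q) (h0 : ∀ ω, 0 ≤ μ ω)
    (h1 : ∑ ω, μ ω = 1)
    {X : Ω → α} {Y : Ω → β} {Y' : Ω → γ}
    (h : condEnt q μ X Y ≤ 0) (hY : Y.FactorsThrough Y') : condEnt q μ X Y' ≤ 0 := by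
  have := ent_add_ent_le hq h0 h1 (A := fun ω => (X ω, Y ω)) (B := Y') (M := Y)
    (J := fun ω => (X ω, Y' ω)) (fun ω ω' h => by simp_all) (fun ω ω' h => by simp_all) hY
  unfold condEnt at *
  linarith

theorem condEnt_nonpos_trans (hq : 1 < q) (h0 : ∀ ω, 0 ≤ μ ω)
    (h1 : ∑ ω, μ ω = 1)
    {X : Ω → α} {Y : Ω → β} {Y' : Ω → γ}
    (h : condEnt q μ X Y ≤ 0) (hY : condEnt q μ Y Y' ≤ 0) : condEnt q μ X Y' ≤ 0 := by
  have e := condEnt_nonpos_of_factorsThrough hq h0 h1 h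
    (Y' := fun ω => (Y ω, Y' ω)) fun ω ω' h => by simp_all
  have := ent_mono hq h0 (X := fun ω => (X ω, Y' ω)) (Y := fun ω => (X ω, (Y ω, Y' ω)))
    fun ω ω' h => by simp_all
  unfold condEnt at *
  linarith

theorem condEnt_prodMk_nonpos (hq : 1 < q) (h0 : ∀ ω, 0 ≤ μ ω)
    (h1 : ∑ ω, μ ω = 1)
    {X : Ω → α} {Y : Ω → β} {Y' : Ω → γ}
    (h : condEnt q μ X Y' ≤ 0) (hY : condEnt q μ Y Y' ≤ 0) :
    condEnt q μ (fun ω => (X ω, Y ω)) Y' ≤ 0 := by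
  have e := condEnt_nonpos_of_factorsThrough hq h0 h1 h
    (Y' := fun ω => (Y ω, Y' ω)) fun ω ω' h => by simp_all
  have := ent_mono hq h0 (X := fun ω => ((X ω, Y ω), Y' ω)) (Y := fun ω => (X ω, (Y ω, Y' ω)))
    fun ω ω' h => by simp_all
  unfold condEnt at *
  linarith

theorem condEnt_nonpos_of_factorsThrough_left (hq : 1 < q) (h0 : ∀ ω, 0 ≤ μ ω)
    {X : Ω → α} {Y : Ω → β}
    (h : X.FactorsThrough Y) : condEnt q μ X Y ≤ 0 := by
  have := ent_mono hq h0 (X := fun ω => (X ω, Y ω)) (Y := Y) fun ω ω' e => by simp [e, h e]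
  unfold condEnt
  linarith

theorem condEnt_restr_nonpos (hq : 1 < q) (h0 : ∀ ω, 0 ≤ μ ω)
    (h1 : ∑ ω, μ ω = 1)
    {ι : Type} [DecidableEq ι] {X : ι → Ω → α} {Y : Ω → β} {A : Finset ι}
    (h : ∀ i ∈ A, condEnt q μ (X i) Y ≤ 0) : condEnt q μ (restr X A) Y ≤ 0 := by
  induction A using Finset.induction_on with
  | empty =>
    exact condEnt_nonpos_of_factorsThrough_left hq h0 fun ω ω' _ => restr_eq_iff.2 (by simp)
  | insert i A hi ih =>
    have hA := ih fun j hj => h j (Finset.mem_insert_of_mem hj)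
    refine condEnt_nonpos_trans hq h0 h1 ?_
      (condEnt_prodMk_nonpos hq h0 h1 (h i (Finset.mem_insert_self i A)) hA)
    refine condEnt_nonpos_of_factorsThrough_left hq h0 fun ω ω' e => ?_
    simpa [restr_eq_iff] using e

/-- Data processing: vanishing conditional mutual information is inherited by functions of the
two arguments, the second one being allowed to use the conditioning variable. -/
theorem ent_add_ent_le_of_mutInfo_eq_zero (hq : 1 < q) (h0 : ∀ ω, 0 ≤ μ ω)
    (h1 : ∑ ω, μ ω = 1)
    {α' β' : Type} [Fintype α'] [Fintype β']
    {X : Ω → α} {Y : Ω → β} {Z : Ω → γ} {X' : Ω → α'} {Y' : Ω → β'}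
    (h : mutInfo q μ X Y Z = 0) (hX : X'.FactorsThrough X)
    (hY : Y'.FactorsThrough fun ω => (Y ω, Z ω)) :
    ent q μ (fun ω => (X' ω, Z ω)) + ent q μ (fun ω => (Y' ω, Z ω)) ≤
      ent q μ (fun ω => (X' ω, Y' ω, Z ω)) + ent q μ Z := by
  have e₁ := ent_add_ent_le hq h0 h1 (A := fun ω => (X ω, Y' ω, Z ω)) (B := fun ω => (Y ω, Z ω))
    (J := fun ω => (X ω, Y ω, Z ω)) (M := fun ω => (Y' ω, Z ω))
    (fun ω ω' e => by simp_all) (fun ω ω' e => by simp_all)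
    (fun ω ω' e => by have := hY e; simp_all)
  have e₂ := ent_add_ent_le hq h0 h1 (A := fun ω => (X' ω, Y' ω, Z ω)) (B := fun ω => (X ω, Z ω))
    (J := fun ω => (X ω, Y' ω, Z ω)) (M := fun ω => (X' ω, Z ω))
    (fun ω ω' e => by simp_all) (fun ω ω' e => by simp_all)
    (fun ω ω' e => by have := @hX ω ω'; simp_all)
  unfold mutInfo condEnt at h
  linarith

theorem ent_le_add_sum (hq : 1 < q) (h0 : ∀ ω, 0 ≤ μ ω)
    (h1 : ∑ ω, μ ω = 1)
    {ι : Type} [DecidableEq ι] {W : ι → Ω → α} {Y : Ω → β} (A : Finset ι) :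
    ent q μ (fun ω => (restr W A ω, Y ω)) ≤ ent q μ Y + ∑ i ∈ A, ent q μ (W i) := by
  induction A using Finset.induction_on with
  | empty =>
    have := ent_mono hq h0 (X := fun ω => (restr W ∅ ω, Y ω)) (Y := Y)
      fun ω ω' e => by simp [restr_eq_iff, e]
    simpa using this
  | insert i A hi ih =>
    have := ent_le_add hq h0 h1 (A := W i) (B := fun ω => (restr W A ω, Y ω))
      (J := fun ω => (restr W (insert i A) ω, Y ω))
      fun ω ω' e => by simp_all [restr_eq_iff]
    rw [Finset.sum_insert hi]
    linarith

/-- An input has full conditional entropy given anything determined by the other inputs and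
an independent variable. -/
theorem ent_add_le_of_independent (hq : 1 < q) (h0 : ∀ ω, 0 ≤ μ ω)
    (h1 : ∑ ω, μ ω = 1)
    {ι : Type} [Fintype ι] [DecidableEq ι] {W : ι → Ω → α} {Y : Ω → β}
    (hind : ent q μ (fun ω => (restr W Finset.univ ω, Y ω)) = ent q μ Y + ∑ i, ent q μ (W i))
    (r : ι) {α' : Type} [Fintype α'] {s : Ω → α'} {E : Ω → γ}
    (hE : E.FactorsThrough fun ω => (restr W (Finset.univ.erase r) ω, Y ω))
    (hs : (W r).FactorsThrough fun ω => (s ω, restr W (Finset.univ.erase r) ω)) :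
    ent q μ E + ent q μ (W r) ≤ ent q μ (fun ω => (s ω, E ω)) := by
  have e₁ := ent_add_ent_le hq h0 h1 (A := fun ω => (restr W (Finset.univ.erase r) ω, Y ω))
    (B := fun ω => (s ω, E ω)) (M := E) (J := fun ω => (restr W Finset.univ ω, Y ω))
    (fun ω ω' e => by
      have := @hs ω ω'
      simp only [restr_eq_iff, Prod.mk.injEq, Finset.mem_erase, Finset.mem_univ, and_true,
        forall_const] at e this ⊢
      refine ⟨fun j => ?_, e.1.2⟩
      by_cases hj : j = r
      · exact hj ▸ this ⟨e.2.1, e.1.1⟩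
      · exact e.1.1 j hj)
    hE (fun ω ω' e => by simp_all)
  have e₂ := ent_le_add_sum hq h0 h1 (W := W) (Y := Y) (Finset.univ.erase r)
  have e₃ := Finset.add_sum_erase Finset.univ (fun i => ent q μ (W i)) (Finset.mem_univ r)
  linarith

end CondEnt

end Entropy

theorem eq_of_sum_eq_of_forall_ne {ι G : Type} [Fintype ι] [DecidableEq ι] [AddCommGroup G]
    {f g : ι → G} {i : ι} (hs : ∑ j, f j = ∑ j, g j) (h : ∀ j, j ≠ i → f j = g j) :
    f i = g i := by
  rw [← Finset.add_sum_erase _ _ (Finset.mem_univ i),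
    ← Finset.add_sum_erase _ g (Finset.mem_univ i),
    Finset.sum_congr rfl fun j hj => h j (Finset.ne_of_mem_erase hj)] at hs
  exact add_right_cancel hs

section Keys

variable {ι F Ω : Type} [Fintype ι] [DecidableEq ι] [Field F] [Fintype F] [Fintype Ω] {μ : Ω → ℝ} {L LX LZ : ℕ}
  {W : ι → Ω → Fin L → F} {Z : ι → Ω → Fin LZ → F} {X : ι → Ω → Fin LX → F}

theorem ent_le_length (h0 : ∀ ω, 0 ≤ μ ω) (h1 : ∑ ω, μ ω = 1) (s : Ω → Fin L → F) :
    ent (Fintype.card F) μ s ≤ L := by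
  have hq : 1 < Fintype.card F := Fintype.one_lt_card
  refine (ent_le_logb_card hq h0 h1 s).trans_eq ?_
  rw [Fintype.card_fun, Fintype.card_fin, Nat.cast_pow, Real.logb_pow,
    Real.logb_self_eq_one (by exact_mod_cast hq), mul_one]

/-- If the sum of the inputs is computable from all messages, then a single message has full
conditional entropy given the inputs and keys of all other users. -/
theorem ent_add_length_le_message (h0 : ∀ ω, 0 ≤ μ ω) (h1 : ∑ ω, μ ω = 1)
    (hW : ∀ i, ent (Fintype.card F) μ (W i) = L)
    (hind : ent (Fintype.card F) μ (fun ω => (restr W Finset.univ ω, restr Z Finset.univ ω)) =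
      ent (Fintype.card F) μ (restr Z Finset.univ) + ∑ i, ent (Fintype.card F) μ (W i))
    (hX : ∀ i, condEnt (Fintype.card F) μ (X i) (fun ω => (W i ω, Z i ω)) ≤ 0)
    (hsum : condEnt (Fintype.card F) μ (fun ω => ∑ i, W i ω) (restr X Finset.univ) ≤ 0)
    (i : ι) :
    ent (Fintype.card F) μ
        (fun ω => (restr W (Finset.univ.erase i) ω, restr Z (Finset.univ.erase i) ω)) + L ≤
      ent (Fintype.card F) μ (fun ω =>
        (X i ω, restr W (Finset.univ.erase i) ω, restr Z (Finset.univ.erase i) ω)) := by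
  have hq : 1 < Fintype.card F := Fintype.one_lt_card
  set D := fun ω => (restr W (Finset.univ.erase i) ω, restr Z (Finset.univ.erase i) ω) with hD
  have hDD : ∀ {ω ω'}, D ω = D ω' ↔ (∀ j ≠ i, W j ω = W j ω') ∧ ∀ j ≠ i, Z j ω = Z j ω' := by
    simp [hD, restr_eq_iff]
  have e₁ := ent_add_le_of_independent hq h0 h1 hind i (s := W i) (E := D)
    (fun ω ω' e => by
      rw [hDD]
      simp only [restr_eq_iff, Prod.mk.injEq, Finset.mem_erase, Finset.mem_univ, and_true] at e
      exact ⟨e.1, fun j _ => e.2 j trivial⟩)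
    (fun ω ω' e => congrArg Prod.fst e)
  have hXall : condEnt (Fintype.card F) μ (restr X Finset.univ) (fun ω => (X i ω, D ω)) ≤ 0 := by
    refine condEnt_restr_nonpos hq h0 h1 fun j _ => ?_
    by_cases hj : j = i
    · subst hj
      exact condEnt_nonpos_of_factorsThrough_left hq h0 fun ω ω' e => congrArg Prod.fst e
    · refine condEnt_nonpos_of_factorsThrough hq h0 h1 (hX j) fun ω ω' e => ?_
      simp only [Prod.mk.injEq, hDD] at e ⊢
      exact ⟨e.2.1 j hj, e.2.2 j hj⟩
  have hs := condEnt_nonpos_trans hq h0 h1 hsum hXall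
  have hWi : condEnt (Fintype.card F) μ (W i) (fun ω => (X i ω, D ω)) ≤ 0 := by
    refine condEnt_nonpos_trans hq h0 h1 ?_ (condEnt_prodMk_nonpos hq h0 h1 hs
      (condEnt_nonpos_of_factorsThrough_left hq h0 (X := D) fun ω ω' e => congrArg Prod.snd e))
    refine condEnt_nonpos_of_factorsThrough_left hq h0 fun ω ω' e => ?_
    simp only [Prod.mk.injEq, hDD] at e
    exact eq_of_sum_eq_of_forall_ne e.1 fun j hj => e.2.1 j hj
  have e₂ := ent_mono hq h0 (X := fun ω => (W i ω, D ω)) (Y := fun ω => (W i ω, X i ω, D ω))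
    fun ω ω' e => by simp_all
  rw [hW] at e₁
  unfold condEnt at hWi
  linarith

/-- The key of user `i` has full conditional entropy given the keys of `T` as soon as the message
of user `i` does not reveal its input to someone knowing the sum of the inputs and the inputs and
keys of `T`. -/
theorem ent_add_length_le_key (h0 : ∀ ω, 0 ≤ μ ω) (h1 : ∑ ω, μ ω = 1)
    (hW : ∀ i, ent (Fintype.card F) μ (W i) = L)
    (hind : ent (Fintype.card F) μ (fun ω => (restr W Finset.univ ω, restr Z Finset.univ ω)) =
      ent (Fintype.card F) μ (restr Z Finset.univ) + ∑ i, ent (Fintype.card F) μ (W i))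
    (hX : ∀ i, condEnt (Fintype.card F) μ (X i) (fun ω => (W i ω, Z i ω)) ≤ 0)
    (hsum : condEnt (Fintype.card F) μ (fun ω => ∑ i, W i ω) (restr X Finset.univ) ≤ 0)
    {T : Finset ι} {i r : ι} (hi : i ∉ T) (hr : r ∉ T) (hri : r ≠ i)
    (hsec : ent (Fintype.card F) μ (fun ω => (X i ω, ∑ j, W j ω, restr W T ω, restr Z T ω)) +
        ent (Fintype.card F) μ (fun ω => (W i ω, ∑ j, W j ω, restr W T ω, restr Z T ω)) ≤
      ent (Fintype.card F) μ (fun ω => (X i ω, W i ω, ∑ j, W j ω, restr W T ω, restr Z T ω)) +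
        ent (Fintype.card F) μ (fun ω => (∑ j, W j ω, restr W T ω, restr Z T ω))) :
    ent (Fintype.card F) μ (restr Z T) + L ≤
      ent (Fintype.card F) μ (restr Z (insert i T)) := by
  have hq : 1 < Fintype.card F := Fintype.one_lt_card
  have hmsg := ent_add_length_le_message h0 h1 hW hind hX hsum i
  set s := fun ω => ∑ j, W j ω with hs
  set C := fun ω => (restr W T ω, restr Z T ω) with hC
  have hCC : ∀ {ω ω'}, C ω = C ω' ↔ (∀ j ∈ T, W j ω = W j ω') ∧ ∀ j ∈ T, Z j ω = Z j ω' := by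
    simp [hC, restr_eq_iff]
  have hmsgC := ent_add_ent_le hq h0 h1 (A := fun ω => (X i ω, C ω))
    (B := fun ω => (restr W (Finset.univ.erase i) ω, restr Z (Finset.univ.erase i) ω)) (M := C)
    (J := fun ω => (X i ω, restr W (Finset.univ.erase i) ω, restr Z (Finset.univ.erase i) ω))
    (fun ω ω' e => by simp_all) (fun ω ω' e => congrArg Prod.snd e)
    (fun ω ω' e => by
      simp only [restr_eq_iff, Prod.mk.injEq, Finset.mem_erase, Finset.mem_univ, and_true] at e
      exact hCC.2 ⟨fun j hj => e.1 j (ne_of_mem_of_not_mem hj hi),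
        fun j hj => e.2 j (ne_of_mem_of_not_mem hj hi)⟩)
  have hsumC := (ent_le_add hq h0 h1 (A := s) (B := C) (J := fun ω => (s ω, C ω))
    fun ω ω' e => e).trans (add_le_add_left (ent_le_length h0 h1 s) _)
  have hsumWC := ent_add_le_of_independent hq h0 h1 hind r (s := s) (E := fun ω => (W i ω, C ω))
    (fun ω ω' e => by
      simp only [restr_eq_iff, Prod.mk.injEq, Finset.mem_erase, Finset.mem_univ, and_true] at e
      simp only [Prod.mk.injEq, hCC]
      exact ⟨e.1 i hri.symm, fun j hj => e.1 j (ne_of_mem_of_not_mem hj hr),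
        fun j _ => e.2 j trivial⟩)
    (fun ω ω' e => by
      simp only [restr_eq_iff, Prod.mk.injEq, Finset.mem_erase, Finset.mem_univ, and_true, hs] at e
      exact eq_of_sum_eq_of_forall_ne e.1 fun j hj => e.2 j hj)
  have hswap := ent_mono hq h0 (X := fun ω => (s ω, W i ω, C ω)) (Y := fun ω => (W i ω, s ω, C ω))
    fun ω ω' e => by simp_all
  have hdrop := ent_add_ent_le hq h0 h1 (A := fun ω => (X i ω, s ω, C ω))
    (B := fun ω => (X i ω, W i ω, C ω)) (M := fun ω => (X i ω, C ω))
    (J := fun ω => (X i ω, W i ω, s ω, C ω))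
    (fun ω ω' e => by simp_all) (fun ω ω' e => by simp_all) (fun ω ω' e => by simp_all)
  have hXi := condEnt_nonpos_of_factorsThrough hq h0 h1 (hX i)
    (Y' := fun ω => (Z i ω, W i ω, C ω)) fun ω ω' e => by simp_all
  have hXZ := ent_mono hq h0 (X := fun ω => (X i ω, W i ω, C ω))
    (Y := fun ω => (X i ω, Z i ω, W i ω, C ω)) fun ω ω' e => by simp_all
  have hZ := ent_add_ent_le hq h0 h1 (A := fun ω => (W i ω, C ω))
    (B := restr Z (insert i T)) (M := restr Z T) (J := fun ω => (Z i ω, W i ω, C ω))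
    (fun ω ω' e => by
      simp only [restr_eq_iff, Prod.mk.injEq, Finset.mem_insert, forall_eq_or_imp] at e ⊢
      exact ⟨e.2.1, e.1⟩)
    (fun ω ω' e => by
      simp only [Prod.mk.injEq, hCC] at e
      exact restr_eq_iff.2 e.2.2)
    (fun ω ω' e => restr_eq_iff.2 fun j hj => restr_eq_iff.1 e j (Finset.mem_insert_of_mem hj))
  rw [hW] at hsumWC
  unfold condEnt at hXi
  linarith

end Keys

theorem card_usr (U : ℕ) (V : Fin U → ℕ) : Fintype.card (Usr U V) = Ktot U V := by
  simp [Ktot]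

theorem BigB_subset_union (U : ℕ) (V : Fin U → ℕ) (A B : Finset (Usr U V)) (u : Fin U) :
    BigB U V A B u ⊆ A ∪ B := by
  have hcard : ∀ w, (Ksrv U V w).card = V w := by
    intro w
    have : Ksrv U V w =
        Finset.univ.map (Function.Embedding.sigmaMk (β := fun u => Fin (V u)) w) := by
      ext ⟨a, b⟩
      simp only [Ksrv, Finset.mem_filter, Finset.mem_univ, true_and, Finset.mem_map,
        Function.Embedding.sigmaMk_apply]
      constructor
      · rintro rfl
        exact ⟨b, rfl⟩
      · rintro ⟨c, hc⟩
        exact (congrArg Sigma.fst hc).symm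
    rw [this, Finset.card_map, Finset.card_univ, Fintype.card_fin]
  refine Finset.union_subset (Finset.union_subset ?_ fun j hj => ?_) Finset.subset_union_right
  · exact Finset.inter_subset_left.trans Finset.subset_union_left
  · simp only [KsrvSet, UServers, Finset.mem_filter, Finset.mem_univ, true_and] at hj
    have := Finset.eq_of_subset_of_card_le Finset.inter_subset_right
      ((hcard j.1).trans hj.2.symm).le
    have hmem : j ∈ (A ∪ B) ∩ Ksrv U V j.1 := by
      rw [this]
      simp [Ksrv]
    exact (Finset.mem_inter.1 hmem).1

/-- A function on finsets that grows by at least `c` at each insertion along a chain from `B` to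
`A ∪ B` grows by at least `c` times the cardinality of `A`. -/
theorem add_card_mul_le_of_insert {ι : Type} [DecidableEq ι] (g : Finset ι → ℝ) (c : ℝ) (A B : Finset ι)
    (h : ∀ i ∈ A, ∀ P, B ⊆ P → P ⊆ A ∪ B → i ∉ P → g P + c ≤ g (insert i P))
    (hAB : Disjoint A B) : g B + A.card * c ≤ g (A ∪ B) := by
  induction A using Finset.induction_on with
  | empty => simp
  | insert i A hi ih =>
    rw [Finset.disjoint_insert_left] at hAB
    have h₁ := ih (fun j hj P hBP hP hjP => h j (Finset.mem_insert_of_mem hj) P hBP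
      (hP.trans (Finset.union_subset_union_left (Finset.subset_insert i A))) hjP) hAB.2
    have h₂ := h i (Finset.mem_insert_self i A) (A ∪ B) Finset.subset_union_right
      (Finset.union_subset_union_left (Finset.subset_insert i A))
      (by simp [hi, hAB.1])
    rw [Finset.insert_union, Finset.card_insert_of_notMem hi]
    push_cast
    linarith

theorem stmt12_lemma4_joint
    (U : ℕ) (hU : 3 ≤ U) (V : Fin U → ℕ) (hV : ∀ u, 1 ≤ V u)
    (M N : ℕ) (S : Fin M → Finset (Usr U V)) (T : Fin N → Finset (Usr U V))
    (hSmono : ∀ (m : Fin M) (A : Finset (Usr U V)), A ⊆ S m → ∃ m', S m' = A)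
    (hTmono : ∀ (n : Fin N) (A : Finset (Usr U V)), A ⊆ T n → ∃ n', T n' = A)
    (hSne : (Finset.univ.biUnion fun m => S m).Nonempty)
    (hTcard : ∀ n, (T n).card ≤ Ktot U V - 2)
    (F : Type) [Field F] [Fintype F] (Ω : Type) [Fintype Ω] (μ : Ω → ℝ)
    (L LX LY LZ LSig : ℕ)
    (W : Usr U V → Ω → Fin L → F) (Z : Usr U V → Ω → Fin LZ → F)
    (X : Usr U V → Ω → Fin LX → F) (Y : Fin U → Ω → Fin LY → F)
    (ZS : Ω → Fin LSig → F)
    (hScheme : IsScheme U V M N S T F Ω μ L LX LY LZ LSig W Z X Y ZS)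
    (n : Fin N) :
    ((T n ∩ Sbar U V S T).card : ℝ) * L ≤ condEnt (Fintype.card F) μ
      (restr Z (T n ∩ Sbar U V S T)) (restr Z (T n \ Sbar U V S T)) := by
  obtain ⟨_, h0, h1, hW, hind, _, _, hX, hY, hcor, hsec⟩ := hScheme
  have hq : 1 < Fintype.card F := Fintype.one_lt_card
  have hX' : ∀ i, condEnt (Fintype.card F) μ (X i) (fun ω => (W i ω, Z i ω)) ≤ 0 :=
    fun i => (hX i).le
  have hsum : condEnt (Fintype.card F) μ (fun ω => ∑ i, W i ω) (restr X Finset.univ) ≤ 0 := by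
    let k : Fin U := ⟨0, by omega⟩
    have hYk : condEnt (Fintype.card F) μ (restr Y (Finset.univ.erase k))
        (restr X Finset.univ) ≤ 0 :=
      condEnt_restr_nonpos hq h0 h1 fun u _ =>
        condEnt_nonpos_of_factorsThrough hq h0 h1 (hY u).le fun ω ω' e =>
          restr_eq_iff.2 fun j _ => restr_eq_iff.1 e j (Finset.mem_univ j)
    have hXk : condEnt (Fintype.card F) μ (restr X (Ksrv U V k)) (restr X Finset.univ) ≤ 0 :=
      condEnt_nonpos_of_factorsThrough_left hq h0 fun ω ω' e =>
        restr_eq_iff.2 fun j _ => restr_eq_iff.1 e j (Finset.mem_univ j)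
    have hobs := condEnt_prodMk_nonpos hq h0 h1 hYk hXk
    exact condEnt_nonpos_trans hq h0 h1 (hcor k).le hobs
  have hobs : ∀ i : Usr U V, (X i).FactorsThrough
      fun ω => (restr Y (Finset.univ.erase i.1) ω, restr X (Ksrv U V i.1) ω) := by
    intro i ω ω' e
    exact restr_eq_iff.1 (congrArg Prod.snd e) i (by simp [Ksrv])
  have hexplicit : ∀ i m P, i ∈ S m → i ∉ P → insert i P ⊆ T n →
      ent (Fintype.card F) μ (restr Z P) + L ≤ ent (Fintype.card F) μ (restr Z (insert i P)) := by
    intro i m P him hiP hP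
    obtain ⟨m', hm'⟩ := hSmono m {i} (by simpa using him)
    obtain ⟨n', rfl⟩ := hTmono n P ((Finset.subset_insert i P).trans hP)
    obtain ⟨r, hr⟩ : ∃ r, r ∉ insert i (T n') := by
      by_contra! hall
      have hle := (Finset.card_le_card hP).trans (hTcard n)
      rw [Finset.eq_univ_of_forall hall, Finset.card_univ, card_usr] at hle
      have := hTcard n
      have hpos : 0 < Ktot U V := by
        rw [← card_usr]
        exact Fintype.card_pos_iff.2 ⟨i⟩
      omega
    rw [Finset.mem_insert, not_or] at hr
    refine ent_add_length_le_key h0 h1 hW hind hX' hsum hiP hr.2 hr.1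
      (ent_add_ent_le_of_mutInfo_eq_zero hq h0 h1 (hsec i.1 m' n') (hobs i) fun ω ω' e => ?_)
    exact restr_eq_iff.1 (congrArg Prod.fst e) i (by simp [hm'])
  have himplicit : ∀ i P, i ∈ SImp U V S T → (∀ j ∈ P, ∀ m, j ∉ S m) → i ∉ P →
      ent (Fintype.card F) μ (restr Z P) + L ≤ ent (Fintype.card F) μ (restr Z (insert i P)) := by
    intro i P hi hPS hiP
    simp only [SImp, Finset.mem_filter, Finset.mem_univ, true_and] at hi
    obtain ⟨hiS, u, m, n', hB, hiB⟩ := hi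
    have hKpos : 0 < Ktot U V := by
      rw [← card_usr]
      exact Fintype.card_pos_iff.2 ⟨i⟩
    have hcompl : BigB U V (S m) (T n') u = Finset.univ.erase i := by
      refine Finset.eq_of_subset_of_card_le
        (fun j hj => Finset.mem_erase.2 ⟨ne_of_mem_of_not_mem hj hiB, Finset.mem_univ j⟩) ?_
      rw [Finset.card_erase_of_mem (Finset.mem_univ i), Finset.card_univ, card_usr, hB]
    have hcover : ∀ j, j ≠ i → j ∈ S m ∨ j ∈ T n' := fun j hj =>
      Finset.mem_union.1 (BigB_subset_union U V _ _ u (hcompl ▸ Finset.mem_erase.2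
        ⟨hj, Finset.mem_univ j⟩))
    have hiT : i ∉ T n' := fun h => hiB (Finset.mem_union_right _ h)
    have hPT : P ⊆ T n' := fun j hj =>
      (hcover j (ne_of_mem_of_not_mem hj hiP)).resolve_left (hPS j hj m)
    obtain ⟨r, hr⟩ : ∃ r, r ∉ insert i (T n') := by
      by_contra! hall
      have hle := hTcard n'
      have hci := Finset.card_insert_of_notMem hiT
      rw [Finset.eq_univ_of_forall hall, Finset.card_univ, card_usr] at hci
      have hK : U ≤ Ktot U V := by
        simpa [Ktot] using Finset.card_nsmul_le_sum Finset.univ V 1 fun u _ => hV u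
      omega
    rw [Finset.mem_insert, not_or] at hr
    obtain ⟨m', hm'⟩ := hSmono m (S m \ T n') Finset.sdiff_subset
    have hkey := ent_add_length_le_key h0 h1 hW hind hX' hsum hiT hr.2 hr.1
      (ent_add_ent_le_of_mutInfo_eq_zero hq h0 h1 (hsec i.1 m' n') (hobs i) fun ω ω' e => by
        simp only [Prod.mk.injEq, restr_eq_iff] at e
        obtain ⟨eS, es, eT, -⟩ := e
        have eW : ∀ j, j ≠ i → W j ω = W j ω' := fun j hj => by
          by_cases hjT : j ∈ T n'
          · exact eT j hjT
          · exact eS j (hm' ▸ Finset.mem_sdiff.2 ⟨(hcover j hj).resolve_right hjT, hjT⟩)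
        exact eq_of_sum_eq_of_forall_ne es eW)
    have hsub := ent_add_ent_le hq h0 h1 (A := restr Z (insert i P)) (B := restr Z (T n'))
      (J := restr Z (insert i (T n'))) (M := restr Z P)
      (fun ω ω' e => by
        simp only [Prod.mk.injEq, restr_eq_iff, Finset.mem_insert, forall_eq_or_imp] at e ⊢
        exact ⟨e.1.1, e.2⟩)
      (fun ω ω' e => restr_eq_iff.2 fun j hj => restr_eq_iff.1 e j (Finset.mem_insert_of_mem hj))
      (fun ω ω' e => restr_eq_iff.2 fun j hj => restr_eq_iff.1 e j (hPT hj))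
    linarith
  set R := T n \ Sbar U V S T with hR
  set E := T n ∩ Finset.univ.biUnion fun m => S m with hE
  set I := T n ∩ SImp U V S T with hI
  have hIS : ∀ i ∈ I, ∀ m, i ∉ S m := fun i hi =>
    (Finset.mem_filter.1 (Finset.mem_inter.1 hi).2).2.1
  have hRS : ∀ i ∈ R, ∀ m, i ∉ S m := fun i hi m him =>
    (Finset.mem_sdiff.1 hi).2 (Finset.mem_union_left _
      (Finset.mem_biUnion.2 ⟨m, Finset.mem_univ m, him⟩))
  have hES : ∀ i ∈ E, ∃ m, i ∈ S m := fun i hi => by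
    simpa using (Finset.mem_inter.1 hi).2
  have hEI : Disjoint E I := Finset.disjoint_left.2 fun i hiE hiI =>
    (hES i hiE).elim fun m hm => hIS i hiI m hm
  have hER : Disjoint E R := Finset.disjoint_left.2 fun i hiE hiR =>
    (hES i hiE).elim fun m hm => hRS i hiR m hm
  have hIR : Disjoint I R := Finset.disjoint_left.2 fun i hiI hiR =>
    (Finset.mem_sdiff.1 hiR).2 (Finset.mem_union_right _ (Finset.mem_inter.1 hiI).2)
  have hTE : T n ∩ Sbar U V S T = E ∪ I := Finset.inter_union_distrib_left _ _ _
  have hsubT : E ∪ (I ∪ R) ⊆ T n := Finset.union_subset Finset.inter_subset_left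
    (Finset.union_subset Finset.inter_subset_left Finset.sdiff_subset)
  have g₁ := add_card_mul_le_of_insert (fun A => ent (Fintype.card F) μ (restr Z A)) L I R
    (fun i hi P _ hP hiP => himplicit i P (Finset.mem_inter.1 hi).2
      (fun j hj => (Finset.mem_union.1 (hP hj)).elim (hIS j) (hRS j)) hiP) hIR
  have g₂ := add_card_mul_le_of_insert (fun A => ent (Fintype.card F) μ (restr Z A)) L E (I ∪ R)
    (fun i hi P _ hP hiP => (hES i hi).elim fun m hm => hexplicit i m P hm hiP
      (Finset.insert_subset (Finset.mem_inter.1 hi).1 (hP.trans hsubT)))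
    (Finset.disjoint_union_right.2 ⟨hEI, hER⟩)
  have g₃ := ent_mono hq h0 (X := restr Z (E ∪ (I ∪ R)))
    (Y := fun ω => (restr Z (E ∪ I) ω, restr Z R ω)) fun ω ω' e => by
      simp only [Prod.mk.injEq, restr_eq_iff, Finset.mem_union] at e ⊢
      rintro j (hj | hj | hj)
      · exact e.1 j (Or.inl hj)
      · exact e.1 j (Or.inr hj)
      · exact e.2 j hj
  rw [hTE, condEnt, Finset.card_union_of_disjoint hEI]
  push_cast
  linarith
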